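/- Let 0<α<1, t₀>0, L>0, μ>0, and let s₂:[0,t₀]→ℝ satisfy s₂(t) ≥ L(t-t₀) + s₂(t₀) for all 0≤t≤t₀. Let m₀>0 be such that E_{α,α}(s)/E_α(s) ≥ m₀ for all s≥0, and choose A>0 such that (A/t₀^{1-α}) m₀ > L. Define f(t) = (1/μ) ln(E_α(μ A t^α)/E_α(μ A t₀^α)) + s₂(t₀) for t∈(0,t₀]. Then there exists t₁∈(0,t₀) such that f(t) < s₂(t) for all t∈(t₁,t₀). -/

import Mathlib

open MeasureTheory Set Filter

/-- The one-parameter Mittag-Leffler function `E_α(z) = Σ_{k≥0} z^k / Γ(αk+1)`. -/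
noncomputable def mittagLeffler (α z : ℝ) : ℝ :=
  ∑' k : ℕ, z ^ k / Real.Gamma (α * k + 1)

/-- The two-parameter Mittag-Leffler function `E_{α,β}(z) = Σ_{k≥0} z^k / Γ(αk+β)`. -/
noncomputable def mittagLeffler₂ (α β z : ℝ) : ℝ :=
  ∑' k : ℕ, z ^ k / Real.Gamma (α * k + β)

/-- The quotient `Γ(x) / Γ(x + a)` decays at least like `x ^ (-a)`, by log-convexity of `Γ`. -/
lemma Real.Gamma_div_Gamma_add_le {a x : ℝ} (ha0 : 0 < a) (ha1 : a < 1) (hx : a ≤ x) :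
    Real.Gamma x / Real.Gamma (x + a) ≤ 2 * x ^ (-a) := by
  have hx0 : 0 < x := ha0.trans_le hx
  have hxa : 0 < x + a := by positivity
  have hG : 0 < Real.Gamma (x + a) := Real.Gamma_pos_of_pos hxa
  have hconv := Real.Gamma_mul_add_mul_le_rpow_Gamma_mul_rpow_Gamma (s := x + a)
    (t := x + a + 1) (a := a) (b := 1 - a) hxa (by positivity) ha0 (by linarith) (by ring)
  have hpt : a * (x + a) + (1 - a) * (x + a + 1) = x + 1 := by ring
  rw [hpt, Real.Gamma_add_one hx0.ne', Real.Gamma_add_one hxa.ne',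
    Real.mul_rpow hxa.le hG.le, mul_left_comm, ← Real.rpow_add hG] at hconv
  have hexp : a + (1 - a) = 1 := by ring
  rw [hexp, Real.rpow_one, sub_eq_add_neg, Real.rpow_add hxa, Real.rpow_one] at hconv
  have hdecay : (x + a) ^ (-a) ≤ x ^ (-a) :=
    Real.rpow_le_rpow_of_nonpos hx0 (by linarith) (by linarith)
  rw [div_le_iff₀ hG]
  refine le_of_mul_le_mul_left (hconv.trans ?_) hx0
  calc (x + a) * (x + a) ^ (-a) * Real.Gamma (x + a)
      ≤ (2 * x) * x ^ (-a) * Real.Gamma (x + a) := by gcongr; linarith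
    _ = x * (2 * x ^ (-a) * Real.Gamma (x + a)) := by ring

lemma Real.tendsto_Gamma_div_Gamma_add {a : ℝ} (ha0 : 0 < a) (ha1 : a < 1) :
    Tendsto (fun x : ℝ => Real.Gamma x / Real.Gamma (x + a)) atTop (nhds 0) := by
  have h : Tendsto (fun x : ℝ => 2 * x ^ (-a)) atTop (nhds 0) := by
    simpa using (tendsto_rpow_neg_atTop ha0).const_mul 2
  refine squeeze_zero' ?_ ?_ h
  · filter_upwards [eventually_ge_atTop a] with x hx
    have hx0 : 0 < x := ha0.trans_le hx
    exact div_nonneg (Real.Gamma_pos_of_pos hx0).le (Real.Gamma_pos_of_pos (by positivity)).le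
  · filter_upwards [eventually_ge_atTop a] with x hx
    exact Real.Gamma_div_Gamma_add_le ha0 ha1 hx

/-- The series defining `E_{α,β}` converges on the whole line. -/
lemma summable_mittagLeffler₂ {α β : ℝ} (hα0 : 0 < α) (hα1 : α < 1) (hβ : 0 < β) (z : ℝ) :
    Summable fun k : ℕ => z ^ k / Real.Gamma (α * k + β) := by
  rcases eq_or_ne z 0 with rfl | hz
  · refine summable_of_ne_finset_zero (s := {0}) fun k hk => ?_
    simp only [Finset.mem_singleton] at hk
    simp [hk]
  have hpos (k : ℕ) : 0 < Real.Gamma (α * k + β) := Real.Gamma_pos_of_pos (by positivity)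
  refine summable_of_ratio_test_tendsto_lt_one (l := 0) one_pos
    (Eventually.of_forall fun k => div_ne_zero (pow_ne_zero k hz) (hpos k).ne') ?_
  have harg : Tendsto (fun k : ℕ => α * (k : ℝ) + β) atTop atTop :=
    tendsto_atTop_add_const_right _ _ (tendsto_natCast_atTop_atTop.const_mul_atTop hα0)
  have hlim := ((Real.tendsto_Gamma_div_Gamma_add hα0 hα1).comp harg).const_mul |z|
  rw [mul_zero] at hlim
  refine hlim.congr fun k => ?_
  have hstep : α * ((k + 1 : ℕ) : ℝ) + β = α * k + β + α := by push_cast; ring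
  have hk' := hpos (k + 1)
  rw [hstep] at hk'
  simp only [Function.comp_apply, hstep, norm_div, norm_pow, Real.norm_eq_abs,
    abs_of_pos (hpos k), abs_of_pos hk']
  have := abs_pos.mpr hz
  have := hpos k
  field_simp
  ring

lemma nat_mul_div_Gamma_succ {α : ℝ} (hα0 : 0 < α) (k : ℕ) (z : ℝ) :
    ((k + 1 : ℕ) : ℝ) * z ^ (k + 1 - 1) / Real.Gamma (α * ((k + 1 : ℕ) : ℝ) + 1) =
      z ^ k / Real.Gamma (α * k + α) / α := by
  have harg : α * ((k + 1 : ℕ) : ℝ) = α * k + α := by push_cast; ring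
  have hpos : 0 < α * (k : ℝ) + α := by positivity
  have hG := Real.Gamma_pos_of_pos hpos
  have hk : ((k + 1 : ℕ) : ℝ) = (α * k + α) / α := by rw [← harg]; field_simp
  rw [harg, Real.Gamma_add_one hpos.ne', hk, Nat.add_sub_cancel]
  field_simp

/-- `E_α' = E_{α,α} / α`. -/
lemma hasDerivAt_mittagLeffler {α : ℝ} (hα0 : 0 < α) (hα1 : α < 1) (z : ℝ) :
    HasDerivAt (mittagLeffler α) (mittagLeffler₂ α α z / α) z := by
  have hsum (x : ℝ) :
      Summable fun k : ℕ => (k : ℝ) * x ^ (k - 1) / Real.Gamma (α * k + 1) := by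
    rw [← summable_nat_add_iff 1]
    simp only [nat_mul_div_Gamma_succ hα0]
    exact (summable_mittagLeffler₂ hα0 hα1 hα0 x).div_const α
  have hz : z ∈ Metric.ball (0 : ℝ) (|z| + 1) := by simp
  have hder := hasDerivAt_tsum_of_isPreconnected (hsum (|z| + 1)) Metric.isOpen_ball
    (convex_ball (0 : ℝ) (|z| + 1)).isPreconnected
    (g := fun (k : ℕ) (x : ℝ) => x ^ k / Real.Gamma (α * k + 1))
    (g' := fun (k : ℕ) (x : ℝ) => (k : ℝ) * x ^ (k - 1) / Real.Gamma (α * k + 1))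
    (fun k x _ => (hasDerivAt_pow k x).div_const _)
    (fun k x hx => by
      have hG : 0 < Real.Gamma (α * k + 1) := Real.Gamma_pos_of_pos (by positivity)
      have hx' : |x| ≤ |z| + 1 := by simpa using (Metric.mem_ball.mp hx).le
      rw [norm_div, norm_mul, norm_pow, Real.norm_eq_abs, Real.norm_eq_abs, Real.norm_eq_abs,
        abs_of_pos hG, Nat.abs_cast]
      gcongr)
    hz (summable_mittagLeffler₂ hα0 hα1 one_pos z) hz
  have hval : ∑' k : ℕ, (k : ℝ) * z ^ (k - 1) / Real.Gamma (α * k + 1) =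
      mittagLeffler₂ α α z / α := by
    rw [(hsum z).tsum_eq_zero_add]
    simp only [nat_mul_div_Gamma_succ hα0, tsum_div_const]
    simp [mittagLeffler₂]
  rw [hval] at hder
  exact hder

/-- A function whose derivative at `b` exceeds `c` lies strictly below the line of slope `c`
through its value at `b` on some interval to the left of `b`. -/
lemma HasDerivAt.exists_lt_line_left {f : ℝ → ℝ} {a b c f' : ℝ} (hab : a < b)
    (hf : HasDerivAt f f' b) (hc : c < f') :
    ∃ t ∈ Ioo a b, ∀ x ∈ Ioo t b, f x < c * (x - b) + f b := by
  have hev : ∀ᶠ x in nhdsWithin b (Iio b), c < slope f b x :=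
    ((hasDerivAt_iff_tendsto_slope.mp hf).mono_left
      (nhdsWithin_mono b fun x hx => ne_of_lt hx)).eventually_const_lt hc
  obtain ⟨l, hl, hlb⟩ := (mem_nhdsLT_iff_exists_Ioo_subset' hab).mp hev
  have hl' : l < b := hl
  refine ⟨(max a l + b) / 2, ⟨?_, ?_⟩, fun x hx => ?_⟩
  · linarith [le_max_left a l]
  · linarith [max_lt hab hl']
  · have hlx : l < x := by linarith [hx.1, le_max_right a l, max_lt hab hl']
    have hslope : c < slope f b x := hlb ⟨hlx, hx.2⟩
    rw [slope_def_field, lt_div_iff_of_neg (sub_neg.mpr hx.2)] at hslope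
    linarith

/-- The auxiliary curve `f(t) = (1/μ) ln(E_α(μA t^α)/E_α(μA t₀^α)) + s₂(t₀)` lies strictly
below `s₂` on some interval `(t₁,t₀)`, provided `s₂(t) ≥ L(t-t₀)+s₂(t₀)` on `[0,t₀]`,
`E_{α,α}/E_α ≥ m₀ > 0` on `[0,∞)` and `A` is chosen with `(A/t₀^(1-α)) m₀ > L`. -/
theorem mlCurve_below_boundary (α t₀ L μ m₀ A : ℝ) (s₂ : ℝ → ℝ)
    (hα0 : 0 < α) (hα1 : α < 1) (ht₀ : 0 < t₀) (hL : 0 < L) (hμ : 0 < μ)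
    (hs₂ : ∀ t ∈ Set.Icc (0:ℝ) t₀, L * (t - t₀) + s₂ t₀ ≤ s₂ t)
    (hm₀ : 0 < m₀)
    (hm : ∀ s : ℝ, 0 ≤ s → m₀ ≤ mittagLeffler₂ α α s / mittagLeffler α s)
    (hA : 0 < A) (hAL : L < A / t₀ ^ (1 - α) * m₀) :
    ∃ t₁ ∈ Set.Ioo (0:ℝ) t₀, ∀ t ∈ Set.Ioo t₁ t₀,
      (1 / μ) * Real.log (mittagLeffler α (μ * A * t ^ α) /
          mittagLeffler α (μ * A * t₀ ^ α)) + s₂ t₀ < s₂ t := by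
  set z := μ * A * t₀ ^ α with hz
  have hz0 : 0 ≤ z := by positivity
  have hmz := hm z hz0
  have hE : mittagLeffler α z ≠ 0 := by
    intro h
    rw [h, div_zero] at hmz
    linarith
  have hinner : HasDerivAt (fun t : ℝ => μ * A * t ^ α) (μ * A * (α * t₀ ^ (α - 1))) t₀ :=
    (Real.hasDerivAt_rpow_const (Or.inl ht₀.ne')).const_mul _
  have hder : HasDerivAt (fun t : ℝ => (1 / μ) * Real.log (mittagLeffler α (μ * A * t ^ α) /
      mittagLeffler α z) + s₂ t₀) _ t₀ :=
    (((((hasDerivAt_mittagLeffler hα0 hα1 z).comp t₀ hinner).div_const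
      (mittagLeffler α z)).log (by exact div_ne_zero hE hE)).const_mul (1 / μ)).add_const (s₂ t₀)
  have hlt : L < 1 / μ * (mittagLeffler₂ α α z / α * (μ * A * (α * t₀ ^ (α - 1))) /
      mittagLeffler α z / (mittagLeffler α z / mittagLeffler α z)) := by
    have hpow : t₀ ^ (α - 1) = (t₀ ^ (1 - α))⁻¹ := by
      rw [← Real.rpow_neg ht₀.le, neg_sub]
    have hp : 0 < t₀ ^ (1 - α) := Real.rpow_pos_of_pos ht₀ _
    calc L < A / t₀ ^ (1 - α) * m₀ := hAL
      _ ≤ A / t₀ ^ (1 - α) * (mittagLeffler₂ α α z / mittagLeffler α z) := by gcongr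
      _ = _ := by
        rw [hpow, div_self hE]
        field_simp
  obtain ⟨t₁, ht₁, hbelow⟩ := hder.exists_lt_line_left ht₀ hlt
  refine ⟨t₁, ht₁, fun t ht => (hbelow t ht).trans_le ?_⟩
  have hline := hs₂ t ⟨(ht₁.1.trans ht.1).le, ht.2.le⟩
  simpa [← hz, div_self hE] using hline
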